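/- Consider a strategic game with nonempty action spaces S_i ⊆ ℝ^{k_i} (i = 1,…,n, n ≥ 2), S := S_1×…×S_n, payoff functions π_i : S → ℝ, and best reply functions f_i : Π_{j≠i} S_j → S_i satisfying π_i(q_i, q_{−i}) < π_i(f_i(q_{−i}), q_{−i}) for all q ∈ S with q_i ≠ f_i(q_{−i}). Suppose q* ∈ S satisfies q_i* = f_i(q*_{−i}) for all i, and that there exist functions γ̃_{i,j} of class N (i ≠ j) with |f_i(q_{−i}) − q_i*| ≤ max_{j≠i} γ̃_{i,j}(|q_j − q_j*|) for all q ∈ S and all i, and ω > 1 such that the cyclic small-gain conditions (3.15) hold for γ_{i,j}(s) := ω·γ̃_{i,j}(ω s). Then q* is the unique Nash equilibrium of the game, i.e., the unique q ∈ S such that π_i(q_i, q_{−i}) ≥ π_i(p, q_{−i}) for every p ∈ S_i and every i. -/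

import Mathlib

open scoped BigOperators

/-- Euclidean norm of a vector in ℝ^m. -/
noncomputable def eNorm {m : ℕ} (v : Fin m → ℝ) : ℝ := Real.sqrt (∑ i, (v i) ^ 2)

/-- Max over indices `j ≠ i` of a finite family of reals (as a supremum). -/
noncomputable def maxNe {n : ℕ} (i : Fin n) (g : Fin n → ℝ) : ℝ :=
  sSup {y | ∃ j, j ≠ i ∧ y = g j}

/-- A function `γ : [0,∞) → [0,∞)` of class N: continuous, non-decreasing, `γ(0)=0`. -/
def ClassN (γ : ℝ → ℝ) : Prop :=
  ContinuousOn γ (Set.Ici 0) ∧ MonotoneOn γ (Set.Ici 0) ∧ γ 0 = 0 ∧ ∀ s, 0 ≤ s → 0 ≤ γ s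

/-- The cyclic composition `γ_{ι 0, ι 1} ∘ γ_{ι 1, ι 2} ∘ ⋯ ∘ γ_{ι (p-1), ι 0}`. -/
noncomputable def cyclicComp {n p : ℕ} (γ : Fin n → Fin n → ℝ → ℝ) (ι : Fin p → Fin n) :
    ℝ → ℝ :=
  (List.ofFn (fun j : Fin p =>
    γ (ι j) (ι ⟨(j.1 + 1) % p, Nat.mod_lt _ j.pos⟩))).foldr (· ∘ ·) id

/-- `q` is a Nash equilibrium: `π_i(q_i, q_{-i}) ≥ π_i(p, q_{-i})` for every `p ∈ S_i`
and every `i`. -/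
def IsNash {n : ℕ} {k : Fin n → ℕ} (Sset : (i : Fin n) → Set (Fin (k i) → ℝ))
    (π : (i : Fin n) → ((j : Fin n) → Fin (k j) → ℝ) → ℝ)
    (q : (j : Fin n) → Fin (k j) → ℝ) : Prop :=
  (∀ j, q j ∈ Sset j) ∧ ∀ i, ∀ p ∈ Sset i, π i (Function.update q i p) ≤ π i q

theorem eNorm_nonneg {m : ℕ} (v : Fin m → ℝ) : 0 ≤ eNorm v := Real.sqrt_nonneg _

theorem eq_zero_of_eNorm_eq_zero {m : ℕ} {v : Fin m → ℝ} (h : eNorm v = 0) : v = 0 := by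
  have hs := (Real.sqrt_eq_zero (Finset.sum_nonneg fun i _ => sq_nonneg (v i))).1 h
  rw [Finset.sum_eq_zero_iff_of_nonneg fun i _ => sq_nonneg (v i)] at hs
  ext i
  simpa using hs i (Finset.mem_univ i)

/-- The supremum over the indices different from `i` is attained. -/
theorem exists_maxNe_eq {n : ℕ} (hn : 2 ≤ n) (i : Fin n) (g : Fin n → ℝ) :
    ∃ j, j ≠ i ∧ maxNe i g = g j := by
  have : Nontrivial (Fin n) := Fin.nontrivial_iff_two_le.2 hn
  obtain ⟨j, hj⟩ := exists_ne i
  have hfin : {y | ∃ j, j ≠ i ∧ y = g j}.Finite :=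
    (Set.finite_range g).subset (by rintro _ ⟨j, -, rfl⟩; exact ⟨j, rfl⟩)
  have hne : {y | ∃ j, j ≠ i ∧ y = g j}.Nonempty := ⟨g j, j, hj, rfl⟩
  exact hne.csSup_mem hfin

/-- Pointwise lower bounds propagate through a composition of functions. -/
theorem le_foldr_comp_ofFn {p : ℕ} (g : Fin p → ℝ → ℝ) (b : ℕ → ℝ)
    (h : ∀ j : Fin p, ∀ s, b (j + 1) ≤ s → b j ≤ g j s) {s : ℝ} (hs : b p ≤ s) :
    b 0 ≤ (List.ofFn g).foldr (· ∘ ·) id s := by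
  induction p generalizing b with
  | zero => simpa using hs
  | succ p ih =>
    rw [List.ofFn_succ, List.foldr_cons]
    exact h 0 _ (ih (fun j => g j.succ) (fun j => b (j + 1)) (fun j s hs => h j.succ s hs) hs)

/-- Every self-map of a finite type has a periodic point on each forward orbit. -/
theorem exists_iterate_mem_periodicPts {α : Type*} [Finite α] (σ : α → α) (x : α) :
    ∃ m, σ^[m] x ∈ Function.periodicPts σ := by
  obtain ⟨m, l, hne, heq⟩ := Finite.exists_ne_map_eq_of_infinite (fun m : ℕ => σ^[m] x)
  wlog hlt : m < l generalizing m l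
  · exact this l m hne.symm heq.symm (by omega)
  refine ⟨m, l - m, by omega, ?_⟩
  change σ^[l - m] (σ^[m] x) = σ^[m] x
  rw [← Function.iterate_add_apply, Nat.sub_add_cancel hlt.le]
  exact heq.symm

/-- A nonnegative vector dominated by its image under the gain operator vanishes if the
enlarged gains satisfy the cyclic small-gain conditions. -/
theorem eq_zero_of_le_maxNe {n : ℕ} (hn : 2 ≤ n) {γ : Fin n → Fin n → ℝ → ℝ}
    (hγ : ∀ i j, i ≠ j → ClassN (γ i j)) {ω : ℝ} (hω : 1 < ω)
    (hSG : ∀ p : ℕ, 2 ≤ p → p ≤ n → ∀ ι : Fin p → Fin n, Function.Injective ι →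
      ∀ s : ℝ, 0 < s → cyclicComp (fun i j s => ω * γ i j (ω * s)) ι s < s)
    {a : Fin n → ℝ} (ha : ∀ i, 0 ≤ a i) (hle : ∀ i, a i ≤ maxNe i fun j => γ i j (a j))
    (i : Fin n) : a i = 0 := by
  by_contra hi
  choose σ hσne hσ using fun i => exists_maxNe_eq hn i fun j => γ i j (a j)
  have hstep : ∀ i, a i ≤ γ i (σ i) (a (σ i)) := fun i => (hle i).trans_eq (hσ i)
  have hpos : ∀ m, 0 < a (σ^[m] i) := by
    intro m
    induction m with
    | zero => exact (ha i).lt_of_ne' hi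
    | succ m ih =>
      refine (ha _).lt_of_ne' fun h0 => ?_
      have h1 := hstep (σ^[m] i)
      rw [← Function.iterate_succ_apply' σ, h0, Function.iterate_succ_apply',
        (hγ _ _ (hσne _).symm).2.2.1] at h1
      linarith
  obtain ⟨m, hm⟩ := exists_iterate_mem_periodicPts σ i
  have hxpos := hpos m
  generalize σ^[m] i = x at hm hxpos
  have hp0 := Function.minimalPeriod_pos_of_mem_periodicPts hm
  have hp1 : Function.minimalPeriod σ x ≠ 1 := fun h =>
    hσne x (Function.minimalPeriod_eq_one_iff_isFixedPt.1 h)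
  have hinj : Function.Injective fun j : Fin (Function.minimalPeriod σ x) => σ^[j] x :=
    fun j l h => Fin.ext (Function.iterate_injOn_Iio_minimalPeriod j.2 l.2 h)
  have hcard := Fintype.card_le_of_injective _ hinj
  rw [Fintype.card_fin, Fintype.card_fin] at hcard
  refine (hSG _ (by omega) hcard _ hinj (a x) hxpos).not_ge ?_
  refine le_foldr_comp_ofFn _ (fun j => a (σ^[j] x)) (fun j s hs => ?_) ?_
  · simp only [Function.iterate_mod_minimalPeriod_eq, Function.iterate_succ_apply'] at hs ⊢
    obtain ⟨-, hmono, -, hnn⟩ := hγ _ _ (hσne (σ^[j] x)).symm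
    have h0 := ha (σ (σ^[j] x))
    have hs0 : 0 ≤ s := h0.trans hs
    have hsω : s ≤ ω * s := le_mul_of_one_le_left hs0 hω.le
    have hωs : 0 ≤ ω * s := hs0.trans hsω
    exact (hstep _).trans <| (hmono h0 hωs (hs.trans hsω)).trans <|
      le_mul_of_one_le_left (hnn _ hωs) hω.le
  · simp [Function.iterate_minimalPeriod]

/-- Under the cyclic small-gain conditions (3.15), a profile `q*` fixed by the best replies
is the unique Nash equilibrium of the strategic game. -/
theorem smallgain_nash_unique (n : ℕ) (hn : 2 ≤ n) (k : Fin n → ℕ)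
    (Sset : (i : Fin n) → Set (Fin (k i) → ℝ)) (hSne : ∀ i, (Sset i).Nonempty)
    (π : (i : Fin n) → ((j : Fin n) → Fin (k j) → ℝ) → ℝ)
    (f : (i : Fin n) → ((j : Fin n) → Fin (k j) → ℝ) → Fin (k i) → ℝ)
    (hf_mem : ∀ i q, (∀ j, q j ∈ Sset j) → f i q ∈ Sset i)
    (hf_indep : ∀ i q q', (∀ j, j ≠ i → q j = q' j) → f i q = f i q')
    (hf_best : ∀ i q, (∀ j, q j ∈ Sset j) → q i ≠ f i q →
      π i q < π i (Function.update q i (f i q)))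
    (qstar : (j : Fin n) → Fin (k j) → ℝ) (hqstarS : ∀ j, qstar j ∈ Sset j)
    (hfix : ∀ i, f i qstar = qstar i)
    (γt : Fin n → Fin n → ℝ → ℝ) (hγ : ∀ i j, i ≠ j → ClassN (γt i j))
    (hbound : ∀ q, (∀ j, q j ∈ Sset j) → ∀ i,
      eNorm (fun m => f i q m - qstar i m) ≤
        maxNe i (fun j => γt i j (eNorm (fun m => q j m - qstar j m))))
    (ω : ℝ) (hω : 1 < ω)
    (hSG : ∀ p : ℕ, 2 ≤ p → p ≤ n → ∀ ι : Fin p → Fin n, Function.Injective ι →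
      ∀ s : ℝ, 0 < s → cyclicComp (fun i j s => ω * γt i j (ω * s)) ι s < s) :
    IsNash Sset π qstar ∧ ∀ q, IsNash Sset π q → q = qstar := by
  refine ⟨⟨hqstarS, fun i p hp => ?_⟩, fun q ⟨hqS, hq⟩ => ?_⟩
  · have hfi : f i (Function.update qstar i p) = qstar i := by
      rw [← hfix i]
      exact hf_indep i _ _ fun j hj => Function.update_of_ne hj _ _
    by_cases hpq : p = qstar i
    · rw [hpq, Function.update_eq_self]
    have hS : ∀ j, Function.update qstar i p j ∈ Sset j := by
      intro j
      rcases eq_or_ne j i with rfl | hj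
      · rwa [Function.update_self]
      · rw [Function.update_of_ne hj]
        exact hqstarS j
    have hlt := hf_best i _ hS (by rwa [hfi, Function.update_self])
    rw [hfi, Function.update_idem, Function.update_eq_self] at hlt
    exact hlt.le
  · have hqf : ∀ i, f i q = q i := fun i => by
      by_contra h
      exact (hf_best i q hqS (Ne.symm h)).not_ge (hq i _ (hf_mem i q hqS))
    funext i
    have h0 := eq_zero_of_le_maxNe hn hγ hω hSG
      (a := fun i => eNorm fun m => q i m - qstar i m) (fun i => eNorm_nonneg _)
      (fun i => by simpa only [hqf] using hbound q hqS i) i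
    exact sub_eq_zero.1 (eq_zero_of_eNorm_eq_zero h0)
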